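/- The group G_ℤ is generated by the elementary transformations: every g ∈ G_ℤ is a finite product of maps of the form φ(C), ψ(D), τ, T(P,Q), and T(t), with C, D ∈ M₃(ℤ) and P, Q ∈ GL₃(ℤ). -/

import Mathlib

open Matrix

namespace FreudenthalZ

/-- The integral cubic Jordan algebra `J_ℤ = M₃(ℤ)`. -/
abbrev MatZ := Matrix (Fin 3) (Fin 3) ℤ

/-- The trace bilinear form `(A, B) = tr(A·B)`. -/
def tb (A B : MatZ) : ℤ := (A * B).trace

/-- The Freudenthal cross product `A × B = (A+B)# − A# − B#` (adjoint = adjugate). -/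
def cross (A B : MatZ) : MatZ := (A + B).adjugate - A.adjugate - B.adjugate

/-- The integral Freudenthal module `M_ℤ = ℤ ⊕ ℤ ⊕ J_ℤ ⊕ J_ℤ`, elements `(α, β, A, B)`. -/
abbrev MZ := ℤ × ℤ × MatZ × MatZ

/-- The quartic norm `q'(x) = ((A,B) − αβ)² − 4(A#,B#) + 4α·det A + 4β·det B`. -/
def qz (x : MZ) : ℤ :=
  (tb x.2.2.1 x.2.2.2 - x.1 * x.2.1) ^ 2 - 4 * tb x.2.2.1.adjugate x.2.2.2.adjugate
    + 4 * x.1 * x.2.2.1.det + 4 * x.2.1 * x.2.2.2.det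

/-- The symplectic form `{x, y} = αδ − βγ + (A,D) − (B,C)`. -/
def symp (x y : MZ) : ℤ :=
  x.1 * y.2.1 - x.2.1 * y.1 + tb x.2.2.1 y.2.2.2 - tb x.2.2.2 y.2.2.1

/-- Membership in the group `G_ℤ`: `ℤ`-linear automorphisms of `M_ℤ`
preserving the quartic norm `q'` and the symplectic form `{·,·}`. -/
def InG (g : MZ → MZ) : Prop :=
  IsLinearMap ℤ g ∧ Function.Bijective g ∧
    (∀ x, qz (g x) = qz x) ∧ (∀ x y, symp (g x) (g y) = symp x y)

/-- `x` is projective: some `g ∈ G_ℤ` maps `x` to a diagonal reduced element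
`(α, β, diag(a₁,a₂,a₃), 0)` (`α > 0`, `α ∣ β`, `α ∣ aᵢ`) satisfying the three gcd
conditions `gcd(α·aᵢ, α·β, aⱼ·a_k) = 1`. -/
def Projective (x : MZ) : Prop :=
  ∃ g : MZ → MZ, InG g ∧ ∃ α β a₁ a₂ a₃ : ℤ,
    g x = (α, β, Matrix.diagonal ![a₁, a₂, a₃], 0) ∧
    0 < α ∧ α ∣ β ∧ α ∣ a₁ ∧ α ∣ a₂ ∧ α ∣ a₃ ∧
    Int.gcd (Int.gcd (α * a₁) (α * β)) (a₂ * a₃) = 1 ∧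
    Int.gcd (Int.gcd (α * a₂) (α * β)) (a₃ * a₁) = 1 ∧
    Int.gcd (Int.gcd (α * a₃) (α * β)) (a₁ * a₂) = 1

end FreudenthalZ

open FreudenthalZ

namespace FreudenthalZ

/-- The elementary transformation
`φ(C) : (α,β,A,B) ↦ (α + (B,C) + (A,C#) + β·det C, β, A + βC, B + A×C + βC#)`. -/
def phiMap (C : MatZ) (x : MZ) : MZ :=
  (x.1 + tb x.2.2.2 C + tb x.2.2.1 C.adjugate + x.2.1 * C.det,
   x.2.1,
   x.2.2.1 + x.2.1 • C,
   x.2.2.2 + cross x.2.2.1 C + x.2.1 • C.adjugate)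

/-- The elementary transformation
`ψ(D) : (α,β,A,B) ↦ (α, β + (A,D) + (B,D#) + α·det D, A + B×D + αD#, B + αD)`. -/
def psiMap (D : MatZ) (x : MZ) : MZ :=
  (x.1,
   x.2.1 + tb x.2.2.1 D + tb x.2.2.2 D.adjugate + x.1 * D.det,
   x.2.2.1 + cross x.2.2.2 D + x.1 • D.adjugate,
   x.2.2.2 + x.1 • D)

/-- The elementary transformation `τ : (α,β,A,B) ↦ (−β, α, −B, A)`. -/
def tauMap (x : MZ) : MZ := (-x.2.1, x.1, -x.2.2.2, x.2.2.1)

/-- The elementary transformation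
`T(P,Q) : (α,β,A,B) ↦ (ε·α, ε·β, P A Q⁻¹, Q B P⁻¹)` with `ε = det P · det Q`. -/
def Tmap (P Q : GL (Fin 3) ℤ) (x : MZ) : MZ :=
  ((P : MatZ).det * (Q : MatZ).det * x.1,
   (P : MatZ).det * (Q : MatZ).det * x.2.1,
   (P : MatZ) * x.2.2.1 * ((Q⁻¹ : GL (Fin 3) ℤ) : MatZ),
   (Q : MatZ) * x.2.2.2 * ((P⁻¹ : GL (Fin 3) ℤ) : MatZ))

/-- The elementary transformation `T(t) : (α,β,A,B) ↦ (α, β, Aᵀ, Bᵀ)`. -/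
def Ttr (x : MZ) : MZ := (x.1, x.2.1, x.2.2.1ᵀ, x.2.2.2ᵀ)


/-- Finite products of the elementary transformations `φ(C)`, `ψ(D)`, `τ`,
`T(P,Q)` and `T(t)`. -/
inductive ZWord : (MZ → MZ) → Prop
  | phi (C : MatZ) : ZWord (phiMap C)
  | psi (D : MatZ) : ZWord (psiMap D)
  | tau : ZWord tauMap
  | tmap (P Q : GL (Fin 3) ℤ) : ZWord (Tmap P Q)
  | ttr : ZWord Ttr
  | comp {g h : MZ → MZ} : ZWord g → ZWord h → ZWord (g ∘ h)

end FreudenthalZ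

namespace FreudenthalZ

theorem tb_exp (A B : MatZ) : tb A B =
    A 0 0 * B 0 0 + A 0 1 * B 1 0 + A 0 2 * B 2 0 + (A 1 0 * B 0 1 + A 1 1 * B 1 1 + A 1 2 * B 2 1)
    + (A 2 0 * B 0 2 + A 2 1 * B 1 2 + A 2 2 * B 2 2) := by
  simp [tb, Matrix.trace_fin_three, Matrix.mul_apply, Fin.sum_univ_three]

theorem qz_mk (α β : ℤ) (A B : MatZ) : qz (α, β, A, B) =
    (tb A B - α * β) ^ 2 - 4 * tb A.adjugate B.adjugate + 4 * α * A.det + 4 * β * B.det := rfl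

theorem symp_mk (α β γ δ : ℤ) (A B C D : MatZ) : symp (α, β, A, B) (γ, δ, C, D) =
    α * δ - β * γ + tb A D - tb B C := rfl

theorem phiMap_mk (α β : ℤ) (A B C : MatZ) : phiMap C (α, β, A, B) =
    (α + tb B C + tb A C.adjugate + β * C.det, β, A + β • C, B + cross A C + β • C.adjugate) := rfl

theorem psiMap_mk (α β : ℤ) (A B D : MatZ) : psiMap D (α, β, A, B) =
    (α, β + tb A D + tb B D.adjugate + α * D.det, A + cross B D + α • D.adjugate, B + α • D) := rfl

theorem tauMap_mk (α β : ℤ) (A B : MatZ) : tauMap (α, β, A, B) = (-β, α, -B, A) := rfl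

theorem phi_add (C D : MatZ) : phiMap (C + D) = phiMap C ∘ phiMap D := by
  funext ⟨α, β, A, B⟩
  simp only [Function.comp, phiMap_mk, Prod.mk.injEq]
  refine ⟨?_, trivial, ?_, ?_⟩
  · simp [tb_exp, cross, Matrix.adjugate_fin_three, Matrix.det_fin_three, -zsmul_eq_mul]
    ring
  · ext i j; simp [-zsmul_eq_mul]; ring
  · ext i j
    fin_cases i <;> fin_cases j <;> simp [cross, Matrix.adjugate_fin_three, -zsmul_eq_mul] <;> ring

theorem phi_zero : phiMap 0 = id := by
  funext ⟨α, β, A, B⟩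
  simp [phiMap_mk, cross, tb]

theorem InG.comp {g h : MZ → MZ} (hg : InG g) (hh : InG h) : InG (g ∘ h) := by
  obtain ⟨a, b, c, d⟩ := hg
  obtain ⟨a', b', c', d'⟩ := hh
  exact ⟨⟨fun x y => by simp [a.map_add, a'.map_add], fun x y => by
    simp [a.map_smul, a'.map_smul, -zsmul_eq_mul]⟩,
    b.comp b', fun x => by simp [c, c'], fun x y => by simp [d, d']⟩

theorem phi_linear (C : MatZ) : IsLinearMap ℤ (phiMap C) := by
  constructor
  · rintro ⟨α, β, A, B⟩ ⟨γ, δ, A', B'⟩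
    simp only [phiMap_mk, Prod.mk_add_mk, Prod.mk.injEq]
    refine ⟨?_, trivial, ?_, ?_⟩
    · simp [tb_exp, -zsmul_eq_mul]; ring
    · ext i j; simp [-zsmul_eq_mul]; ring
    · ext i j
      fin_cases i <;> fin_cases j <;> simp [cross, Matrix.adjugate_fin_three, -zsmul_eq_mul] <;> ring
  · rintro c ⟨α, β, A, B⟩
    simp only [phiMap_mk, Prod.smul_mk, Prod.mk.injEq]
    refine ⟨?_, trivial, ?_, ?_⟩
    · simp [tb_exp, -zsmul_eq_mul]; ring
    · ext i j; simp [-zsmul_eq_mul]; ring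
    · ext i j
      fin_cases i <;> fin_cases j <;> simp [cross, Matrix.adjugate_fin_three, -zsmul_eq_mul] <;> ring

theorem phi_bij (C : MatZ) : Function.Bijective (phiMap C) := by
  refine Function.bijective_iff_has_inverse.2 ⟨phiMap (-C), fun x => ?_, fun x => ?_⟩
  · have := congrFun (phi_add (-C) C) x
    simpa [phi_zero] using this.symm
  · have := congrFun (phi_add C (-C)) x
    simpa [phi_zero] using this.symm

set_option maxRecDepth 4000 in
theorem phi_symp (C : MatZ) (x y : MZ) : symp (phiMap C x) (phiMap C y) = symp x y := by
  obtain ⟨α, β, A, B⟩ := x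
  obtain ⟨γ, δ, A', B'⟩ := y
  simp [phiMap_mk, symp_mk, tb_exp, cross, Matrix.adjugate_fin_three, Matrix.det_fin_three, -zsmul_eq_mul]
  ring

theorem phi_single_qz (i j : Fin 3) (c : ℤ) (x : MZ) :
    qz (phiMap (Matrix.single i j c) x) = qz x := by
  obtain ⟨α, β, A, B⟩ := x
  rw [← sub_eq_zero]
  fin_cases i <;> fin_cases j <;>
  · simp [phiMap_mk, qz_mk, tb_exp, cross, Matrix.adjugate_fin_three, Matrix.det_fin_three,
      -zsmul_eq_mul]
    ring

theorem phi_qz (C : MatZ) : ∀ x, qz (phiMap C x) = qz x := by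
  induction C using Matrix.induction_on' with
  | h_zero => simp [phi_zero]
  | h_add p q hp hq => intro x; rw [phi_add]; simp [hp, hq]
  | h_std_basis i j c => exact phi_single_qz i j c

theorem phi_InG (C : MatZ) : InG (phiMap C) :=
  ⟨phi_linear C, phi_bij C, phi_qz C, phi_symp C⟩

theorem tau_InG : InG tauMap := by
  refine ⟨⟨?_, ?_⟩, ?_, ?_, ?_⟩
  · rintro ⟨α, β, A, B⟩ ⟨γ, δ, A', B'⟩
    simp [tauMap_mk, add_comm]
  · rintro c ⟨α, β, A, B⟩
    simp [tauMap_mk]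
  · refine Function.bijective_iff_has_inverse.2 ⟨fun x => - tauMap x, ?_, ?_⟩
    · rintro ⟨α, β, A, B⟩; simp [tauMap_mk]
    · rintro ⟨α, β, A, B⟩; simp [tauMap_mk]
  · rintro ⟨α, β, A, B⟩
    simp [tauMap_mk, qz_mk, tb_exp, Matrix.adjugate_fin_three, Matrix.det_fin_three, -zsmul_eq_mul]
    ring
  · rintro ⟨α, β, A, B⟩ ⟨γ, δ, A', B'⟩
    simp [tauMap_mk, symp_mk, tb_exp]
    ring

theorem neg_InG : InG (fun x => -x) := by
  refine ⟨⟨?_, ?_⟩, ?_, ?_, ?_⟩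
  · intro x y; exact neg_add x y
  · intro c x; simp
  · exact neg_bijective
  · rintro ⟨α, β, A, B⟩
    simp [qz_mk, tb_exp, Matrix.adjugate_fin_three, Matrix.det_fin_three, -zsmul_eq_mul]
    ring
  · rintro ⟨α, β, A, B⟩ ⟨γ, δ, A', B'⟩
    simp [symp_mk, tb_exp]

theorem neg_ZWord : ZWord (fun x => -x) := by
  have : (fun x : MZ => -x) = Tmap (-1) 1 := by
    funext ⟨α, β, A, B⟩
    simp [Tmap, Matrix.det_neg]
  rw [this]
  exact ZWord.tmap _ _

/-- A pair of mutually inverse words, both lying in `G`. -/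
structure GW (w v : MZ → MZ) : Prop where
  zw : ZWord w
  zv : ZWord v
  gw : InG w
  gv : InG v
  inv : ∀ x, v (w x) = x

theorem GW.comp {w v w' v' : MZ → MZ} (h : GW w v) (h' : GW w' v') :
    GW (w ∘ w') (v' ∘ v) :=
  ⟨h.zw.comp h'.zw, h'.zv.comp h.zv, h.gw.comp h'.gw, h'.gv.comp h.gv,
    fun x => by simp [h.inv, h'.inv]⟩

theorem GW_phi (C : MatZ) : GW (phiMap C) (phiMap (-C)) :=
  ⟨.phi _, .phi _, phi_InG _, phi_InG _, fun x => by
    have := congrFun (phi_add (-C) C) x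
    simpa [phi_zero] using this.symm⟩

theorem GW_neg : GW (fun x => -x) (fun x => -x) :=
  ⟨neg_ZWord, neg_ZWord, neg_InG, neg_InG, fun x => neg_neg x⟩

theorem GW_tau : GW tauMap ((fun x => -x) ∘ tauMap) :=
  ⟨.tau, neg_ZWord.comp .tau, tau_InG, neg_InG.comp tau_InG, by
    rintro ⟨α, β, A, B⟩; simp [tauMap_mk]⟩

theorem GW_tau' : GW ((fun x => -x) ∘ tauMap) tauMap :=
  ⟨neg_ZWord.comp .tau, .tau, neg_InG.comp tau_InG, tau_InG, by
    rintro ⟨α, β, A, B⟩; simp [tauMap_mk]⟩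

theorem psi_eq (D : MatZ) : psiMap D = tauMap ∘ phiMap (-D) ∘ ((fun x => -x) ∘ tauMap) := by
  funext ⟨α, β, A, B⟩
  simp only [Function.comp, phiMap_mk, psiMap_mk, tauMap_mk, Prod.neg_mk, Prod.mk.injEq]
  refine ⟨by simp, ?_, ?_, ?_⟩
  · simp [tb_exp, Matrix.adjugate_fin_three, Matrix.det_fin_three, -zsmul_eq_mul]
    ring
  · ext i j
    fin_cases i <;> fin_cases j <;> simp [cross, Matrix.adjugate_fin_three, -zsmul_eq_mul] <;> ring
  · ext i j; simp

theorem GW_psi (D : MatZ) : ∃ v, GW (psiMap D) v := by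
  rw [psi_eq]
  exact ⟨_, GW_tau.comp ((GW_phi _).comp GW_tau')⟩

/-- Intrinsic rank one condition. -/
def R1 (x : MZ) : Prop := ∀ y, qz (y + x) + qz (y - x) - 2 * qz y = 2 * symp x y ^ 2

theorem R1_e : R1 (1, 0, 0, 0) := by
  rintro ⟨α, β, A, B⟩
  simp only [Prod.mk_add_mk, Prod.mk_sub_mk, qz_mk, symp_mk, add_zero, sub_zero]
  simp [tb]
  ring

theorem R1_f : R1 (0, 1, 0, 0) := by
  rintro ⟨α, β, A, B⟩
  simp only [Prod.mk_add_mk, Prod.mk_sub_mk, qz_mk, symp_mk, add_zero, sub_zero]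
  simp [tb]
  ring

theorem R1.map {g : MZ → MZ} (hg : InG g) {x : MZ} (hx : R1 x) : R1 (g x) := by
  intro y
  obtain ⟨y, rfl⟩ := hg.2.1.2 y
  rw [← hg.1.map_add, ← hg.1.map_sub, hg.2.2.1, hg.2.2.1, hg.2.2.1, hg.2.2.2, hx y]

theorem R1_zero {α β : ℤ} {A : MatZ} (h : R1 (α, β, A, 0)) (ha : α ≠ 0) : A = 0 ∧ β = 0 := by
  have h0 : 4 * qz (α, β, A, 0) = 0 := by
    have h0 := h 0
    rw [show (0 : MZ) = (0, 0, 0, 0) from rfl] at h0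
    simp only [Prod.mk_add_mk, Prod.mk_sub_mk, qz_mk, symp_mk, tb_exp] at h0 ⊢
    simp [Matrix.adjugate_fin_three, Matrix.det_fin_three] at h0 ⊢
    linarith
  have hb := h (1, 1, 0, 0)
  have key : ∀ C : MatZ, tb C.adjugate A = 0 := by
    intro C
    have h1 := h (0, 0, C, 0)
    have h2 : (8 * α) * tb C.adjugate A = 0 := by
      simp only [Prod.mk_add_mk, Prod.mk_sub_mk, qz_mk, symp_mk, tb_exp,
        Matrix.adjugate_fin_three, Matrix.det_fin_three] at h0 h1 ⊢
      simp only [Matrix.of_apply, Matrix.cons_val, Matrix.add_apply, Matrix.sub_apply,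
        Matrix.zero_apply] at h0 h1 ⊢
      have h0' : 2 * (((α * β) ^ 2) + 4 * α * (A 0 0 * A 1 1 * A 2 2 - A 0 0 * A 1 2 * A 2 1 - A 0 1 * A 1 0 * A 2 2 + A 0 1 * A 1 2 * A 2 0 + A 0 2 * A 1 0 * A 2 1 - A 0 2 * A 1 1 * A 2 0)) = 0 := by
        linarith
      linear_combination h1 - h0'
    rcases mul_eq_zero.1 h2 with h3 | h3
    · omega
    · exact h3
  have hA : A = 0 := by
    ext i j
    have k1 := key !![0,0,0;0,1,0;0,0,1]
    have k2 := key !![0,0,0;1,0,0;0,0,1]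
    have k3 := key !![0,0,0;1,0,0;0,1,0]
    have k4 := key !![0,1,0;0,0,0;0,0,1]
    have k5 := key !![1,0,0;0,0,0;0,0,1]
    have k6 := key !![1,0,0;0,0,0;0,1,0]
    have k7 := key !![0,1,0;0,0,1;0,0,0]
    have k8 := key !![1,0,0;0,0,1;0,0,0]
    have k9 := key !![1,0,0;0,1,0;0,0,0]
    simp [tb_exp, Matrix.adjugate_fin_three] at k1 k2 k3 k4 k5 k6 k7 k8 k9
    fin_cases i <;> fin_cases j <;> simp <;> assumption
  subst hA
  refine ⟨rfl, ?_⟩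
  have : α * β = 0 := by
    simp only [Prod.mk_add_mk, Prod.mk_sub_mk, qz_mk, symp_mk, tb_exp] at h0 hb
    simp [Matrix.adjugate_fin_three, Matrix.det_fin_three] at h0 hb
    rcases h0 with h | h <;> simp [h]
  rcases mul_eq_zero.1 this with h | h
  · exact absurd h ha
  · exact h

end FreudenthalZ
namespace FreudenthalZ

theorem euclid_step {α b : ℤ} (hα : α ≠ 0) (hb : 0 < b) (hlt : b < |α|) :
    ∃ c : ℤ, α + c * b ≠ 0 ∧ (α + c * b).natAbs < α.natAbs := by
  rw [Int.abs_eq_natAbs] at hlt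
  have h1 := Int.emod_nonneg α hb.ne'
  have h2 := Int.emod_lt_of_pos α hb
  have h3 := Int.emod_add_mul_ediv α b
  by_cases h : α % b = 0
  · refine ⟨-(α / b) + 1, ?_⟩
    have : α + (-(α / b) + 1) * b = b := by linear_combination -h3 + h
    rw [this]; omega
  · refine ⟨-(α / b), ?_⟩
    have : α + (-(α / b)) * b = α % b := by linear_combination -h3
    rw [this]; omega

theorem reduce_aux (n : ℕ) : ∀ x : MZ, x.1.natAbs = n → x.1 ≠ 0 → R1 x →
    ∃ w v, GW w v ∧ ∃ α : ℤ, w x = (α, 0, 0, 0) := by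
  induction n using Nat.strong_induction_on with
  | _ n ih =>
  rintro ⟨α, β, A, B⟩ hn h0 hR
  simp only at hn h0
  by_cases hdiv : ∀ i j, α ∣ B i j
  · choose D hD using hdiv
    obtain ⟨v, hv⟩ := GW_psi (-(Matrix.of D))
    refine ⟨_, v, hv, α, ?_⟩
    have hR' := hR.map hv.gw
    have hB : B + α • (-(Matrix.of D)) = 0 := by
      ext i j; simp [hD i j]
    rw [psiMap_mk, hB] at hR' ⊢
    obtain ⟨h1, h2⟩ := R1_zero hR' h0
    rw [h1, h2]
  · push Not at hdiv
    obtain ⟨i, j, hij⟩ := hdiv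
    obtain ⟨v, hv⟩ := GW_psi (Matrix.single i j (-(B i j / α)))
    set x' := psiMap (Matrix.single i j (-(B i j / α))) (α, β, A, B) with hx'
    have e1 : x'.1 = α := rfl
    have e2 : x'.2.2.2 i j = B i j % α := by
      have := Int.emod_add_mul_ediv (B i j) α
      simp [hx', psiMap_mk]
      linear_combination -this
    have hb : 0 < B i j % α := by
      have := Int.emod_nonneg (B i j) h0
      have h3 : B i j % α ≠ 0 := fun h => hij (Int.dvd_of_emod_eq_zero h)
      omega
    obtain ⟨c, hc0, hc⟩ := euclid_step h0 hb (Int.emod_lt_abs _ h0)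
    have hp := GW_phi (Matrix.single j i c)
    have e3 : (phiMap (Matrix.single j i c) x').1 = α + c * (B i j % α) := by
      rw [← e2, ← e1]
      generalize x' = z
      obtain ⟨a, b, A', B'⟩ := z
      fin_cases i <;> fin_cases j <;>
      · simp [phiMap_mk, tb_exp, Matrix.adjugate_fin_three, Matrix.det_fin_three]
        try ring
    obtain ⟨w', v', hw', a, ha⟩ := ih _ (by rw [← hn]; rw [← e3] at hc; exact hc) _ rfl
      (by rw [e3]; exact hc0) ((hR.map hv.gw).map hp.gw)
    exact ⟨_, _, hw'.comp (hp.comp hv), a, ha⟩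

theorem GW_id : GW id id := by
  have := GW_phi 0
  simpa [phi_zero] using this

theorem exists_ne_zero (x : MZ) (hx : x ≠ 0) : ∃ w v, GW w v ∧ (w x).1 ≠ 0 := by
  by_contra! hcon
  apply hx
  have hB : ∀ w v, GW w v → (w x).2.2.2 = 0 := by
    intro w v hw
    ext i j
    have h1 := hcon _ _ ((GW_phi (Matrix.single j i 1)).comp hw)
    have h2 := hcon _ _ hw
    have h3 := hcon _ _ (GW_tau.comp hw)
    simp only [Function.comp] at h1 h2 h3
    generalize w x = z at *
    obtain ⟨a, b, A', B'⟩ := z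
    simp [tauMap_mk] at h2 h3
    subst h2 h3
    fin_cases i <;> fin_cases j <;>
    · simpa [phiMap_mk, tb_exp, Matrix.adjugate_fin_three, Matrix.det_fin_three] using h1
  have h1 := hcon _ _ GW_id
  have h2 := hcon _ _ GW_tau
  have h3 := hB _ _ GW_id
  have h4 := hB _ _ GW_tau
  obtain ⟨a, b, A', B'⟩ := x
  simp [tauMap_mk] at h1 h2 h3 h4
  subst h1 h2 h3 h4
  rfl

theorem move_e (g : MZ → MZ) (hg : InG g) :
    ∃ w v, GW w v ∧ w (g (1, 0, 0, 0)) = (1, 0, 0, 0) := by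
  have hR := R1_e.map hg
  have hne : g (1, 0, 0, 0) ≠ 0 := by
    intro h
    have := hg.2.1.1 (h.trans hg.1.map_zero.symm)
    simp at this
  obtain ⟨w, v, hw, h0⟩ := exists_ne_zero _ hne
  obtain ⟨w', v', hw', α, hα⟩ := reduce_aux _ _ rfl h0 (hR.map hw.gw)
  have hs := (hw'.gw.comp (hw.gw.comp hg)).2.2.2 (1, 0, 0, 0) (0, 1, 0, 0)
  simp only [Function.comp] at hs
  rw [hα] at hs
  generalize w' (w (g (0, 1, 0, 0))) = z at hs
  obtain ⟨a, b, A', B'⟩ := z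
  simp [symp_mk, tb] at hs
  rcases Int.eq_one_or_neg_one_of_mul_eq_one hs with h | h
  · exact ⟨_, _, hw'.comp hw, by simp [hα, h]⟩
  · exact ⟨_, _, GW_neg.comp (hw'.comp hw), by simp [hα, h]⟩

theorem move_ef (g : MZ → MZ) (hg : InG g) :
    ∃ w v, GW w v ∧ w (g (1, 0, 0, 0)) = (1, 0, 0, 0) ∧ w (g (0, 1, 0, 0)) = (0, 1, 0, 0) := by
  obtain ⟨w, v, hw, he⟩ := move_e g hg
  have hR := R1_f.map (hw.gw.comp hg)
  have hs := (hw.gw.comp hg).2.2.2 (1, 0, 0, 0) (0, 1, 0, 0)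
  simp only [Function.comp] at hs hR
  rw [he] at hs
  rcases hz : w (g (0, 1, 0, 0)) with ⟨a, b, A, B⟩
  rw [hz] at hs hR
  simp [symp_mk, tb] at hs
  subst hs
  refine ⟨_, _, (GW_phi (-A)).comp hw, ?_, ?_⟩
  · simp only [Function.comp, he]
    simp [phiMap_mk, tb, cross]
  · have hR2 := (hR.map (phi_InG (-A))).map tau_InG
    simp only [Function.comp, hz]
    rw [phiMap_mk] at hR2 ⊢
    have hA : A + (1 : ℤ) • (-A) = 0 := by simp
    rw [hA] at hR2 ⊢
    rw [tauMap_mk] at hR2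
    obtain ⟨h1, h2⟩ := R1_zero hR2 (by norm_num)
    rw [h2, neg_eq_zero.1 h1]

end FreudenthalZ
namespace FreudenthalZ

theorem tb_nondeg {Y : MatZ} (h : ∀ X, tb X Y = 0) : Y = 0 := by
  ext i j
  have := h (Matrix.single j i 1)
  rw [tb, Matrix.trace_single_mul] at this
  simpa using this

theorem det_pm (X A : MatZ) : (X + A).det + (X - A).det = 2 * X.det + 2 * tb X A.adjugate := by
  simp [tb_exp, Matrix.adjugate_fin_three, Matrix.det_fin_three]
  ring

theorem det_pm_one (A : MatZ) : (A + 1).det + (A - 1).det = 2 * A.det + 2 * A.trace := by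
  simp [Matrix.trace_fin_three, Matrix.det_fin_three]
  ring

theorem sq_eq (A : MatZ) : A * A = A.adjugate + A.trace • A - A.adjugate.trace • 1 := by
  ext i j
  fin_cases i <;> fin_cases j <;>
  · simp [Matrix.adjugate_fin_three, Matrix.trace_fin_three, Matrix.mul_apply,
      Fin.sum_univ_three, -zsmul_eq_mul, -zsmul_one]
    ring

theorem tr_sq (A : MatZ) : (A * A).trace = A.trace ^ 2 - 2 * A.adjugate.trace := by
  simp [Matrix.adjugate_fin_three, Matrix.trace_fin_three, Matrix.mul_apply,
      Fin.sum_univ_three]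
  ring

theorem jordan_of_det (L : MatZ →ₗ[ℤ] MatZ) (hs : Function.Surjective L) (h1 : L 1 = 1)
    (hd : ∀ A, (L A).det = A.det) :
    (∀ A, L A.adjugate = (L A).adjugate) ∧ (∀ A, (L A).trace = A.trace) ∧
    (∀ A, L (A * A) = L A * L A) := by
  have htr : ∀ A, (L A).trace = A.trace := by
    intro A
    have e1 := det_pm_one A
    have e2 := det_pm_one (L A)
    rw [← h1, ← map_add, ← map_sub, hd, hd, hd] at e2
    linarith
  have hX : ∀ X A, tb (L X) (L A).adjugate = tb X A.adjugate := by
    intro X A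
    have e1 := det_pm X A
    have e2 := det_pm (L X) (L A)
    rw [← map_add, ← map_sub, hd, hd, hd] at e2
    linarith
  have hS : ∀ A, (L A).adjugate.trace = A.adjugate.trace := by
    intro A
    have := hX 1 A
    simpa [h1, tb] using this
  have hT2 : ∀ A, (L A * L A).trace = (A * A).trace := by
    intro A
    rw [tr_sq, tr_sq, htr, hS]
  have hT : ∀ A B, tb (L A) (L B) = tb A B := by
    intro A B
    have e1 := hT2 (A + B)
    have e2 := hT2 A
    have e3 := hT2 B
    have c1 := Matrix.trace_mul_comm A B
    have c2 := Matrix.trace_mul_comm (L A) (L B)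
    simp only [map_add, mul_add, add_mul, Matrix.trace_add] at e1
    simp only [tb]
    linarith
  have hadj : ∀ A, L A.adjugate = (L A).adjugate := by
    intro A
    rw [← sub_eq_zero]
    apply tb_nondeg
    intro X
    obtain ⟨X, rfl⟩ := hs X
    have e1 := hT X A.adjugate
    have e2 := hX X A
    simp only [tb, mul_sub, Matrix.trace_sub] at *
    linarith
  refine ⟨hadj, htr, fun A => ?_⟩
  rw [sq_eq, sq_eq, map_sub, map_add, hadj, map_smul, map_smul, h1, htr, hS]

theorem row_gcd (r : Fin 3 → ℤ) : ∃ (d : ℤ) (v w : Fin 3 → ℤ), (∀ k, r k = d * v k) ∧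
    d = r 0 * w 0 + r 1 * w 1 + r 2 * w 2 := by
  obtain ⟨d, hd⟩ := IsPrincipalIdealRing.principal (Ideal.span (Set.range r))
  have hmem : ∀ k, ∃ v, r k = d * v := by
    intro k
    have : r k ∈ Ideal.span (Set.range r) := Ideal.subset_span ⟨k, rfl⟩
    rw [hd] at this
    exact Ideal.mem_span_singleton.1 this
  choose v hv using hmem
  have hdm : d ∈ Ideal.span (Set.range r) := by
    rw [hd]; exact Ideal.mem_span_singleton_self d
  obtain ⟨w, hw⟩ := (Ideal.mem_span_range_iff_exists_fun).1 hdm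
  refine ⟨d, v, w, hv, ?_⟩
  rw [← hw, Fin.sum_univ_three]
  ring

theorem adj_zero_minor {F : MatZ} (h : F.adjugate = 0) (a b c d : Fin 3) :
    F a b * F c d = F a d * F c b := by
  have k : ∀ i j, F.adjugate i j = 0 := fun i j => by rw [h]; rfl
  have k00 := k 0 0
  have k01 := k 0 1
  have k02 := k 0 2
  have k10 := k 1 0
  have k11 := k 1 1
  have k12 := k 1 2
  have k20 := k 2 0
  have k21 := k 2 1
  have k22 := k 2 2
  simp [Matrix.adjugate_fin_three] at k00 k01 k02 k10 k11 k12 k20 k21 k22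
  fin_cases a <;> fin_cases b <;> fin_cases c <;> fin_cases d <;> simp <;> linarith

theorem rank_one {F : MatZ} (h : F.adjugate = 0) : ∃ u v : Fin 3 → ℤ, ∀ i j, F i j = u i * v j := by
  by_cases hF : F = 0
  · exact ⟨0, 0, by simp [hF]⟩
  have : ∃ i j, F i j ≠ 0 := by
    by_contra! hc
    exact hF (by ext i j; exact hc i j)
  obtain ⟨i0, j0, h0⟩ := this
  obtain ⟨d, v, w, hv, hd⟩ := row_gcd (F i0)
  have hd0 : d ≠ 0 := by
    rintro rfl
    exact h0 (by simp [hv])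
  have hm : ∀ i j k, F i k * v j = F i j * v k := by
    intro i j k
    have := adj_zero_minor h i k i0 j
    rw [hv, hv] at this
    apply mul_left_cancel₀ hd0
    linear_combination this
  have hvw : v 0 * w 0 + v 1 * w 1 + v 2 * w 2 = 1 := by
    rw [hv, hv, hv] at hd
    apply mul_left_cancel₀ hd0
    linear_combination -hd
  refine ⟨fun i => F i 0 * w 0 + F i 1 * w 1 + F i 2 * w 2, v, fun i j => ?_⟩
  linear_combination -(F i j) * hvw - w 0 * hm i j 0 - w 1 * hm i j 1 - w 2 * hm i j 2

theorem idem_orth {E F : MatZ} (hE : E * E = E) (hF : F * F = F) (h : E * F + F * E = 0) :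
    E * F = 0 := by
  have e1 : E * F + E * F * E = 0 := by
    have := congrArg (fun X => E * X) h
    simpa [mul_add, ← mul_assoc, hE] using this
  have e2 : E * F * E + F * E = 0 := by
    have := congrArg (fun X => X * E) h
    simpa [add_mul, mul_assoc, hE] using this
  have e3 : E * F = F * E := by
    have := e1.trans e2.symm
    rw [add_comm] at this
    exact add_left_cancel this
  rw [← e3] at h
  ext i j
  have := congrFun (congrFun h i) j
  simp only [Matrix.add_apply, Matrix.zero_apply] at this ⊢
  omega

theorem jordan_pol {L : MatZ →ₗ[ℤ] MatZ} (hq : ∀ A, L (A * A) = L A * L A) (A B : MatZ) :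
    L (A * B + B * A) = L A * L B + L B * L A := by
  have e := hq (A + B)
  simp only [map_add, mul_add, add_mul] at e ⊢
  rw [hq A, hq B] at e
  have : ∀ a b c d c' d' : MatZ, a + d + (c + b) = a + d' + (c' + b) → c + d = c' + d' := by
    intro a b c d c' d' h
    have := congrArg (fun x => x - a - b) h
    have h1 : a + d + (c + b) - a - b = c + d := by abel
    have h2 : a + d' + (c' + b) - a - b = c' + d' := by abel
    rw [← h1, ← h2, this]
  exact this _ _ _ _ _ _ e

/-- Simultaneous diagonalization of the images of the diagonal idempotents. -/
theorem diag_frame (L : MatZ →ₗ[ℤ] MatZ) (h1 : L 1 = 1)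
    (hadj : ∀ A, L A.adjugate = (L A).adjugate) (htr : ∀ A, (L A).trace = A.trace)
    (hq : ∀ A, L (A * A) = L A * L A) :
    ∃ U V : MatZ, U * V = 1 ∧ V * U = 1 ∧
      ∀ i, V * L (Matrix.single i i 1) * U = Matrix.single i i 1 := by
  have hr : ∀ i : Fin 3, ∃ u v : Fin 3 → ℤ, ∀ a b, L (Matrix.single i i 1) a b = u a * v b := by
    intro i
    apply rank_one
    rw [← hadj]
    have : (Matrix.single i i (1 : ℤ)).adjugate = 0 := by
      ext a b
      fin_cases i <;> fin_cases a <;> fin_cases b <;> simp [Matrix.adjugate_fin_three]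
    rw [this, map_zero]
  choose u v huv using hr
  have hid : ∀ i : Fin 3, L (Matrix.single i i 1) * L (Matrix.single i i 1)
      = L (Matrix.single i i 1) := by
    intro i
    rw [← hq]; simp
  have horth : ∀ i j : Fin 3, i ≠ j → L (Matrix.single i i 1) * L (Matrix.single j j 1) = 0 := by
    intro i j hij
    apply idem_orth (hid i) (hid j)
    rw [← jordan_pol hq]
    simp [Matrix.single_mul_single_of_ne, hij, hij.symm]
  have hvu1 : ∀ i, v i 0 * u i 0 + v i 1 * u i 1 + v i 2 * u i 2 = 1 := by
    intro i
    have := htr (Matrix.single i i 1)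
    rw [Matrix.trace_fin_three, Matrix.trace_single_eq_same, huv, huv, huv] at this
    linarith
  have hnu : ∀ i, ∃ a, u i a ≠ 0 := by
    intro i
    by_contra! hc
    have := hvu1 i
    simp [hc] at this
  have hnv : ∀ i, ∃ a, v i a ≠ 0 := by
    intro i
    by_contra! hc
    have := hvu1 i
    simp [hc] at this
  have hvu0 : ∀ i j, i ≠ j → v i 0 * u j 0 + v i 1 * u j 1 + v i 2 * u j 2 = 0 := by
    intro i j hij
    obtain ⟨a, ha⟩ := hnu i
    obtain ⟨b, hb⟩ := hnv j
    have := congrFun (congrFun (horth i j hij) a) b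
    rw [Matrix.mul_apply, Fin.sum_univ_three] at this
    simp only [huv, Matrix.zero_apply] at this
    have h2 : u i a * v j b * (v i 0 * u j 0 + v i 1 * u j 1 + v i 2 * u j 2) = 0 := by
      linarith
    rcases mul_eq_zero.1 h2 with h3 | h3
    · rcases mul_eq_zero.1 h3 with h4 | h4
      · exact absurd h4 ha
      · exact absurd h4 hb
    · exact h3
  have hvu : ∀ i j, v i 0 * u j 0 + v i 1 * u j 1 + v i 2 * u j 2 = if i = j then 1 else 0 := by
    intro i j
    split_ifs with h
    · subst h; exact hvu1 i
    · exact hvu0 i j h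
  have hVU : (Matrix.of v) * (Matrix.of u)ᵀ = 1 := by
    ext i j
    rw [Matrix.mul_apply, Fin.sum_univ_three, Matrix.one_apply, ← hvu i j]
    rfl
  refine ⟨(Matrix.of u)ᵀ, Matrix.of v, mul_eq_one_comm.1 hVU, hVU, fun i => ?_⟩
  ext a b
  have : (Matrix.of v * L (Matrix.single i i 1) * (Matrix.of u)ᵀ) a b =
      (v a 0 * u i 0 + v a 1 * u i 1 + v a 2 * u i 2) *
      (v i 0 * u b 0 + v i 1 * u b 1 + v i 2 * u b 2) := by
    simp only [Matrix.mul_apply, Fin.sum_univ_three, huv, Matrix.of_apply, Matrix.transpose_apply]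
    ring
  rw [this, hvu, hvu, Matrix.single_apply]
  by_cases h : i = a <;> by_cases h' : i = b <;> simp [h, h', eq_comm]

end FreudenthalZ
namespace FreudenthalZ

theorem single_mul_entry (i a b : Fin 3) (X : MatZ) :
    ((Matrix.single i i 1 : MatZ) * X) a b = if a = i then X a b else 0 := by
  split_ifs with h
  · subst h; simp
  · simp [h]

theorem mul_single_entry (i a b : Fin 3) (X : MatZ) :
    (X * (Matrix.single i i 1 : MatZ)) a b = if b = i then X a b else 0 := by
  split_ifs with h
  · subst h; simp
  · simp [h]

theorem peirce_supp {i j : Fin 3} (hij : i ≠ j) {X : MatZ}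
    (h1 : Matrix.single i i 1 * X + X * Matrix.single i i 1 = X)
    (h2 : Matrix.single j j 1 * X + X * Matrix.single j j 1 = X) :
    X = Matrix.single i j (X i j) + Matrix.single j i (X j i) := by
  ext a b
  have e1 := congrFun (congrFun h1 a) b
  have e2 := congrFun (congrFun h2 a) b
  simp only [Matrix.add_apply, single_mul_entry, mul_single_entry] at e1 e2
  rw [Matrix.add_apply, Matrix.single_apply, Matrix.single_apply]
  grind

theorem peirce_pair (L : MatZ →ₗ[ℤ] MatZ) (hq : ∀ A, L (A * A) = L A * L A)
    (hfix : ∀ i, L (Matrix.single i i 1) = Matrix.single i i 1) {i j : Fin 3} (hij : i ≠ j) :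
    ∃ s : ℤ, s * s = 1 ∧
      ((L (Matrix.single i j 1) = Matrix.single i j s ∧
        L (Matrix.single j i 1) = Matrix.single j i s) ∨
       (L (Matrix.single i j 1) = Matrix.single j i s ∧
        L (Matrix.single j i 1) = Matrix.single i j s)) := by
  have hsupp : ∀ i j : Fin 3, i ≠ j → ∃ x y : ℤ, x * y = 0 ∧
      L (Matrix.single i j 1) = Matrix.single i j x + Matrix.single j i y := by
    intro i j hij
    have e1 := jordan_pol hq (Matrix.single i i 1) (Matrix.single i j 1)
    have e2 := jordan_pol hq (Matrix.single j j 1) (Matrix.single i j 1)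
    have e3 := hq (Matrix.single i j 1)
    simp [hfix, hij, hij.symm] at e1 e2 e3
    have hX := peirce_supp hij e1.symm e2.symm
    refine ⟨_, _, ?_, hX⟩
    have e4 := congrFun (congrFun e3 i) i
    rw [hX] at e4
    simpa [add_mul, mul_add, hij, hij.symm] using e4
  obtain ⟨x, y, hxy, hX⟩ := hsupp i j hij
  obtain ⟨z, t, hzt, hY⟩ := hsupp j i hij.symm
  have e := jordan_pol hq (Matrix.single i j 1) (Matrix.single j i 1)
  have e4 := congrFun (congrFun e i) i
  rw [hX, hY] at e4
  simp [add_mul, mul_add, hij, hij.symm, hfix] at e4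
  rcases mul_eq_zero.1 hxy with h | h
  · subst h
    have h5 : y * t = 1 := by linarith
    have hz : z = 0 := by
      rcases mul_eq_zero.1 hzt with h | h
      · exact h
      · subst h; simp at h5
    subst hz
    rcases Int.mul_eq_one_iff_eq_one_or_neg_one.1 h5 with ⟨rfl, rfl⟩ | ⟨rfl, rfl⟩
    · exact ⟨1, rfl, Or.inr ⟨by simpa using hX, by simpa using hY⟩⟩
    · exact ⟨-1, rfl, Or.inr ⟨by simpa using hX, by simpa using hY⟩⟩
  · subst h
    have h5 : x * z = 1 := by linarith
    have hz : t = 0 := by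
      rcases mul_eq_zero.1 hzt with h | h
      · subst h; simp at h5
      · exact h
    subst hz
    rcases Int.mul_eq_one_iff_eq_one_or_neg_one.1 h5 with ⟨rfl, rfl⟩ | ⟨rfl, rfl⟩
    · exact ⟨1, rfl, Or.inl ⟨by simpa using hX, by simpa using hY⟩⟩
    · exact ⟨-1, rfl, Or.inl ⟨by simpa using hX, by simpa using hY⟩⟩

theorem mat_decomp (A : MatZ) : A =
    A 0 0 • Matrix.single 0 0 1 + A 0 1 • Matrix.single 0 1 1 + A 0 2 • Matrix.single 0 2 1 +
    A 1 0 • Matrix.single 1 0 1 + A 1 1 • Matrix.single 1 1 1 + A 1 2 • Matrix.single 1 2 1 +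
    A 2 0 • Matrix.single 2 0 1 + A 2 1 • Matrix.single 2 1 1 + A 2 2 • Matrix.single 2 2 1 := by
  ext i j
  fin_cases i <;> fin_cases j <;> simp [-zsmul_eq_mul]

/-- The straight case: conjugation by a diagonal sign matrix. -/
theorem jordan_straight (L : MatZ →ₗ[ℤ] MatZ) (hq : ∀ A, L (A * A) = L A * L A)
    (hfix : ∀ i, L (Matrix.single i i 1) = Matrix.single i i 1) {s t : ℤ}
    (hs : s * s = 1) (ht : t * t = 1)
    (h01 : L (Matrix.single 0 1 1) = Matrix.single 0 1 s)
    (h10 : L (Matrix.single 1 0 1) = Matrix.single 1 0 s)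
    (h12 : L (Matrix.single 1 2 1) = Matrix.single 1 2 t)
    (h21 : L (Matrix.single 2 1 1) = Matrix.single 2 1 t) :
    ∃ S : MatZ, S * S = 1 ∧ ∀ A, L A = S * A * S := by
  have h02 : L (Matrix.single 0 2 1) = Matrix.single 0 2 (s * t) := by
    have e := jordan_pol hq (Matrix.single 0 1 1) (Matrix.single 1 2 1)
    simpa [h01, h12] using e
  have h20 : L (Matrix.single 2 0 1) = Matrix.single 2 0 (s * t) := by
    have e := jordan_pol hq (Matrix.single 2 1 1) (Matrix.single 1 0 1)
    simpa [h21, h10, mul_comm] using e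
  refine ⟨Matrix.diagonal ![1, s, s * t], ?_, fun A => ?_⟩
  · ext i j
    fin_cases i <;> fin_cases j <;> simp [hs]
    linear_combination s * s * ht + hs
  · conv_lhs => rw [mat_decomp A]
    simp only [map_add, map_smul, hfix, h01, h10, h12, h21, h02, h20]
    ext i j
    fin_cases i <;> fin_cases j <;> simp [-zsmul_eq_mul] <;> grind

theorem jordan_fixed (L : MatZ →ₗ[ℤ] MatZ) (hs : Function.Surjective L)
    (hq : ∀ A, L (A * A) = L A * L A)
    (hfix : ∀ i, L (Matrix.single i i 1) = Matrix.single i i 1) :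
    ∃ S : MatZ, S * S = 1 ∧ ((∀ A, L A = S * A * S) ∨ (∀ A, L A = S * Aᵀ * S)) := by
  obtain ⟨s, hs, h | h⟩ := peirce_pair L hq hfix (show (0 : Fin 3) ≠ 1 by decide) <;>
  obtain ⟨t, ht, h' | h'⟩ := peirce_pair L hq hfix (show (1 : Fin 3) ≠ 2 by decide)
  · obtain ⟨S, hS, hL⟩ := jordan_straight L hq hfix hs ht h.1 h.2 h'.1 h'.2
    exact ⟨S, hS, Or.inl hL⟩
  · exfalso
    have e := jordan_pol hq (Matrix.single 0 1 1) (Matrix.single 1 2 1)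
    obtain ⟨r, hr, h3 | h3⟩ := peirce_pair L hq hfix (show (0 : Fin 3) ≠ 2 by decide)
    · simp [h.1, h'.1, h3.1] at e
      have := congrFun (congrFun e 0) 2
      simp at this
      subst this
      simp at hr
    · simp [h.1, h'.1, h3.1] at e
      have := congrFun (congrFun e 2) 0
      simp at this
      subst this
      simp at hr
  · exfalso
    have e := jordan_pol hq (Matrix.single 0 1 1) (Matrix.single 1 2 1)
    obtain ⟨r, hr, h3 | h3⟩ := peirce_pair L hq hfix (show (0 : Fin 3) ≠ 2 by decide)
    · simp [h.1, h'.1, h3.1] at e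
      have := congrFun (congrFun e 0) 2
      simp at this
      subst this
      simp at hr
    · simp [h.1, h'.1, h3.1] at e
      have := congrFun (congrFun e 2) 0
      simp at this
      subst this
      simp at hr
  · let L' : MatZ →ₗ[ℤ] MatZ := L ∘ₗ (Matrix.transposeLinearEquiv (Fin 3) (Fin 3) ℤ ℤ).toLinearMap
    have hL' : ∀ A, L' A = L Aᵀ := fun A => rfl
    obtain ⟨S, hS, hL⟩ := jordan_straight L' (by intro A; simp [hL', hq]) (by
      intro i; simp [hL', hfix]) hs ht (by simp [hL', h.2])
      (by simp [hL', h.1]) (by simp [hL', h'.2]) (by simp [hL', h'.1])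
    refine ⟨S, hS, Or.inr fun A => ?_⟩
    rw [← hL, hL', Matrix.transpose_transpose]

theorem frobenius (L : MatZ →ₗ[ℤ] MatZ) (hs : Function.Surjective L)
    (hd : ∀ A, (L A).det = A.det) :
    ∃ P P' Q Q' : MatZ, P * P' = 1 ∧ Q * Q' = 1 ∧
      ((∀ A, L A = P * A * Q') ∨ (∀ A, L A = P * Aᵀ * Q')) := by
  have hdet : IsUnit (L 1).det := by rw [hd]; simp
  have hinv : (L 1)⁻¹ * L 1 = 1 := Matrix.nonsing_inv_mul _ hdet
  have hinv' : L 1 * (L 1)⁻¹ = 1 := Matrix.mul_nonsing_inv _ hdet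
  let L1 : MatZ →ₗ[ℤ] MatZ := LinearMap.mulLeft ℤ (L 1)⁻¹ ∘ₗ L
  have hL1 : ∀ A, L1 A = (L 1)⁻¹ * L A := fun A => rfl
  have hs1 : Function.Surjective L1 := by
    intro X
    obtain ⟨A, hA⟩ := hs (L 1 * X)
    exact ⟨A, by rw [hL1, hA, ← mul_assoc, hinv, one_mul]⟩
  have hdi : (L 1)⁻¹.det = 1 := by
    have := congrArg Matrix.det hinv
    rw [Matrix.det_mul, hd] at this
    simpa using this
  obtain ⟨hadj, htr, hq⟩ := jordan_of_det L1 hs1 (by rw [hL1, hinv])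
    (fun A => by rw [hL1, Matrix.det_mul, hdi, hd, one_mul])
  obtain ⟨U, V, hUV, hVU, hf⟩ := diag_frame L1 (by rw [hL1, hinv]) hadj htr hq
  let L2 : MatZ →ₗ[ℤ] MatZ := LinearMap.mulRight ℤ U ∘ₗ LinearMap.mulLeft ℤ V ∘ₗ L1
  have hL2 : ∀ A, L2 A = V * L1 A * U := fun A => rfl
  obtain ⟨S, hS, hSL⟩ := jordan_fixed L2 (by
      intro X
      obtain ⟨A, hA⟩ := hs1 (U * X * V)
      refine ⟨A, ?_⟩
      rw [hL2, hA]
      calc V * (U * X * V) * U = (V * U) * X * (V * U) := by simp only [mul_assoc]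
        _ = X := by simp [hVU])
    (by
      intro A
      rw [hL2, hL2, hq]
      calc V * (L1 A * L1 A) * U = V * L1 A * 1 * L1 A * U := by simp only [mul_assoc, one_mul]
        _ = V * L1 A * U * (V * L1 A * U) := by rw [← hUV]; simp only [mul_assoc])
    (fun i => by rw [hL2, hf])
  have hback : ∀ A, L A = L 1 * U * L2 A * V := by
    intro A
    rw [hL2, hL1]
    calc L A = (L 1 * (L 1)⁻¹) * L A := by rw [hinv', one_mul]
      _ = L 1 * 1 * (L 1)⁻¹ * L A * 1 := by simp only [mul_one]
      _ = _ := by rw [← hUV]; simp only [mul_assoc]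
  refine ⟨L 1 * U * S, S * V * (L 1)⁻¹, U * S, S * V, ?_, ?_, ?_⟩
  · calc L 1 * U * S * (S * V * (L 1)⁻¹) = L 1 * U * (S * S) * V * (L 1)⁻¹ := by
          simp only [mul_assoc]
      _ = L 1 * (U * V) * (L 1)⁻¹ := by rw [hS]; simp only [mul_assoc, one_mul]
      _ = 1 := by rw [hUV, mul_one, hinv']
  · calc U * S * (S * V) = U * (S * S) * V := by simp only [mul_assoc]
      _ = 1 := by rw [hS, mul_one, hUV]
  · rcases hSL with h | h
    · left; intro A; rw [hback, h]; simp only [mul_assoc]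
    · right; intro A; rw [hback, h]; simp only [mul_assoc]

end FreudenthalZ
namespace FreudenthalZ

theorem det_radical {Y : MatZ} (h : ∀ X : MatZ, (X + Y).det = X.det)
    (h' : ∀ X : MatZ, (X - Y).det = X.det) : Y = 0 := by
  have hadj : Y.adjugate = 0 := by
    apply tb_nondeg
    intro X
    have := det_pm X Y
    rw [h, h'] at this
    linarith
  have key : ∀ C : MatZ, tb C.adjugate Y = 0 := by
    intro C
    have h1 := h C
    have h0 : Y.det = 0 := by simpa using h 0
    have h2 : tb C Y.adjugate = 0 := by rw [hadj]; simp [tb]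
    simp [tb_exp, Matrix.adjugate_fin_three, Matrix.det_fin_three] at h0 h1 h2 ⊢
    linear_combination h1 - h0 - h2
  ext i j
  have k1 := key !![0,0,0;0,1,0;0,0,1]
  have k2 := key !![0,0,0;1,0,0;0,0,1]
  have k3 := key !![0,0,0;1,0,0;0,1,0]
  have k4 := key !![0,1,0;0,0,0;0,0,1]
  have k5 := key !![1,0,0;0,0,0;0,0,1]
  have k6 := key !![1,0,0;0,0,0;0,1,0]
  have k7 := key !![0,1,0;0,0,1;0,0,0]
  have k8 := key !![1,0,0;0,0,1;0,0,0]
  have k9 := key !![1,0,0;0,1,0;0,0,0]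
  simp [tb_exp, Matrix.adjugate_fin_three] at k1 k2 k3 k4 k5 k6 k7 k8 k9
  fin_cases i <;> fin_cases j <;> simp <;> assumption

theorem fixed_levi (h : MZ → MZ) (hg : InG h) (he : h (1, 0, 0, 0) = (1, 0, 0, 0))
    (hf : h (0, 1, 0, 0) = (0, 1, 0, 0)) : ZWord h := by
  obtain ⟨hlin, hbij, hqz, hsy⟩ := hg
  have h1 : ∀ x, (h x).1 = x.1 := by
    intro x
    have := hsy x (0, 1, 0, 0)
    rw [hf] at this
    simpa [symp, tb] using this
  have h2 : ∀ x, (h x).2.1 = x.2.1 := by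
    intro x
    have := hsy (1, 0, 0, 0) x
    rw [he] at this
    simpa [symp, tb] using this
  have hdec : ∀ α β A B, h (α, β, A, B) = α • (1, 0, 0, 0) + β • (0, 1, 0, 0) + h (0, 0, A, B) := by
    intro α β A B
    rw [← he, ← hf, ← hlin.map_smul, ← hlin.map_smul, ← hlin.map_add, ← hlin.map_add]
    congr 1
    simp
  have hdecA : ∀ α β A B, (h (α, β, A, B)).2.2.1 = (h (0, 0, A, B)).2.2.1 := by
    intro α β A B
    rw [hdec]; simp
  have hdecB : ∀ α β A B, (h (α, β, A, B)).2.2.2 = (h (0, 0, A, B)).2.2.2 := by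
    intro α β A B
    rw [hdec]; simp
  have hdA : ∀ A B, (h (0, 0, A, B)).2.2.1.det = A.det := by
    intro A B
    have e1 := hqz (0, 0, A, B)
    have e2 := hqz (1, 0, A, B)
    simp only [qz, h1, h2, hdecA 1, hdecB 1] at e1 e2
    linarith
  have hdB : ∀ A B, (h (0, 0, A, B)).2.2.2.det = B.det := by
    intro A B
    have e1 := hqz (0, 0, A, B)
    have e2 := hqz (0, 1, A, B)
    simp only [qz, h1, h2, hdecA 0 1, hdecB 0 1] at e1 e2
    linarith
  have hadd : ∀ A B C D, h (0, 0, A + C, B + D) = h (0, 0, A, B) + h (0, 0, C, D) := by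
    intro A B C D
    rw [← hlin.map_add]; simp
  have hsub : ∀ A B C D, h (0, 0, A - C, B - D) = h (0, 0, A, B) - h (0, 0, C, D) := by
    intro A B C D
    rw [← hlin.map_sub]; simp
  have hsurj : ∀ X Y, ∃ A B, h (0, 0, A, B) = (0, 0, X, Y) := by
    intro X Y
    obtain ⟨⟨α, β, A, B⟩, hx⟩ := hbij.2 (0, 0, X, Y)
    have e1 := h1 (α, β, A, B)
    have e2 := h2 (α, β, A, B)
    rw [hx] at e1 e2
    simp only at e1 e2
    subst e1 e2
    exact ⟨A, B, hx⟩
  have hA0 : ∀ B, (h (0, 0, 0, B)).2.2.1 = 0 := by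
    intro B
    apply det_radical
    · intro X
      obtain ⟨A', B', hx⟩ := hsurj X 0
      have e1 := hdA (A' + 0) (B' + B)
      have e2 := hdA A' B'
      rw [hadd, hx] at e1
      rw [hx] at e2
      simpa [← e2] using e1
    · intro X
      obtain ⟨A', B', hx⟩ := hsurj X 0
      have e1 := hdA (A' - 0) (B' - B)
      have e2 := hdA A' B'
      rw [hsub, hx] at e1
      rw [hx] at e2
      simpa [← e2] using e1
  have hB0 : ∀ A, (h (0, 0, A, 0)).2.2.2 = 0 := by
    intro A
    apply det_radical
    · intro X
      obtain ⟨A', B', hx⟩ := hsurj 0 X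
      have e1 := hdB (A' + A) (B' + 0)
      have e2 := hdB A' B'
      rw [hadd, hx] at e1
      rw [hx] at e2
      simpa [← e2] using e1
    · intro X
      obtain ⟨A', B', hx⟩ := hsurj 0 X
      have e1 := hdB (A' - A) (B' - 0)
      have e2 := hdB A' B'
      rw [hsub, hx] at e1
      rw [hx] at e2
      simpa [← e2] using e1
  have hLA : ∀ A B, (h (0, 0, A, B)).2.2.1 = (h (0, 0, A, 0)).2.2.1 := by
    intro A B
    have := hadd A 0 0 B
    simp only [add_zero, zero_add] at this
    rw [this]; simp [hA0]
  have hMB : ∀ A B, (h (0, 0, A, B)).2.2.2 = (h (0, 0, 0, B)).2.2.2 := by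
    intro A B
    have := hadd A 0 0 B
    simp only [add_zero, zero_add] at this
    rw [this]; simp [hB0]
  let L : MatZ →ₗ[ℤ] MatZ :=
    { toFun := fun A => (h (0, 0, A, 0)).2.2.1
      map_add' := by
        intro A B
        have := hadd A 0 B 0
        rw [add_zero] at this
        rw [this]; rfl
      map_smul' := by
        intro c A
        have := hlin.map_smul c (0, 0, A, 0)
        simp only [Prod.smul_mk, smul_zero] at this
        rw [this]; rfl }
  have hL : ∀ A, (h (0, 0, A, 0)).2.2.1 = L A := fun A => rfl
  have hform : ∀ α β A B, h (α, β, A, B) = (α, β, L A, (h (0, 0, 0, B)).2.2.2) := by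
    intro α β A B
    have a1 := h1 (α, β, A, B)
    have a2 := h2 (α, β, A, B)
    have a3 := hdecA α β A B
    have a4 := hdecB α β A B
    rw [hLA, hL] at a3
    rw [hMB] at a4
    exact Prod.ext a1 (Prod.ext a2 (Prod.ext a3 a4))
  have hLs : Function.Surjective L := by
    intro X
    obtain ⟨A, B, hx⟩ := hsurj X 0
    exact ⟨A, by rw [← hL, ← hLA A B, hx]⟩
  have hLd : ∀ A, (L A).det = A.det := fun A => hdA A 0
  have hdual : ∀ A B, tb (L A) (h (0, 0, 0, B)).2.2.2 = tb A B := by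
    intro A B
    have := hsy (0, 0, A, 0) (0, 0, 0, B)
    rw [hform 0 0 A, hform 0 0 0 B] at this
    simpa [symp, tb, hB0] using this
  obtain ⟨P, P', Q, Q', hP, hQ, hcase⟩ := frobenius L hLs hLd
  have hP' := mul_eq_one_comm.1 hP
  have hQ' := mul_eq_one_comm.1 hQ
  have hdQ : Q.det * Q'.det = 1 := by rw [← Matrix.det_mul, hQ, Matrix.det_one]
  have hε : P.det * Q.det = 1 := by
    have e : P.det * Q'.det = 1 := by
      have := hLd 1
      rcases hcase with h | h <;> simpa [h, Matrix.det_mul] using this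
    rcases Int.mul_eq_one_iff_eq_one_or_neg_one.1 hdQ with ⟨a, b⟩ | ⟨a, b⟩ <;>
      rw [b] at e <;> rw [a] <;> exact e
  let PG : GL (Fin 3) ℤ := ⟨P, P', hP, hP'⟩
  let QG : GL (Fin 3) ℤ := ⟨Q, Q', hQ, hQ'⟩
  have hT : ∀ α β A B, Tmap PG QG (α, β, A, B) = (α, β, P * A * Q', Q * B * P') := by
    intro α β A B
    change (P.det * Q.det * α, P.det * Q.det * β, P * A * Q', Q * B * P') = _
    rw [hε, one_mul, one_mul]
  have hcan : ∀ A B : MatZ, tb (P * A * Q') (Q * B * P') = tb A B := by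
    intro A B
    simp only [tb]
    calc (P * A * Q' * (Q * B * P')).trace = (P * (A * (Q' * Q) * B * P')).trace := by
          simp only [mul_assoc]
      _ = (A * B * (P' * P)).trace := by
          rw [Matrix.trace_mul_comm, hQ', mul_one]; simp only [mul_assoc]
      _ = _ := by rw [hP', mul_one]
  have htt : ∀ A B : MatZ, tb Aᵀ Bᵀ = tb A B := by
    intro A B
    simp only [tb, ← Matrix.transpose_mul, Matrix.trace_transpose]
    exact Matrix.trace_mul_comm _ _
  have huniq : ∀ Y Z : MatZ, (∀ A, tb (L A) Y = tb (L A) Z) → Y = Z := by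
    intro Y Z hYZ
    rw [← sub_eq_zero]
    apply tb_nondeg
    intro X
    obtain ⟨A, rfl⟩ := hLs X
    have := hYZ A
    simp only [tb, mul_sub, Matrix.trace_sub] at *
    linarith
  rcases hcase with hc | hc
  · have : h = Tmap PG QG := by
      funext ⟨α, β, A, B⟩
      rw [hform, hT, hc]
      have : (h (0, 0, 0, B)).2.2.2 = Q * B * P' := huniq _ _ fun A => by
        rw [hdual, hc, hcan]
      rw [this]
    rw [this]; exact ZWord.tmap _ _
  · have : h = Tmap PG QG ∘ Ttr := by
      funext ⟨α, β, A, B⟩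
      change _ = Tmap PG QG (α, β, Aᵀ, Bᵀ)
      rw [hform, hT, hc]
      have : (h (0, 0, 0, B)).2.2.2 = Q * Bᵀ * P' := huniq _ _ fun A => by
        rw [hdual, hc, hcan, htt]
      rw [this]
    rw [this]; exact (ZWord.tmap _ _).comp .ttr

end FreudenthalZ

/-- **Generators of `G_ℤ`**: every `ℤ`-linear automorphism of `M_ℤ` preserving the
quartic norm `q'` and the symplectic form is a finite product of the elementary
transformations `φ(C)`, `ψ(D)`, `τ`, `T(P,Q)`, `T(t)`. -/
theorem generators_of_GZ (g : MZ → MZ) (hg : InG g) : FreudenthalZ.ZWord g := by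
  obtain ⟨w, v, hw, he, hf⟩ := FreudenthalZ.move_ef g hg
  have h := FreudenthalZ.fixed_levi (w ∘ g) (hw.gw.comp hg) he hf
  have hgv : g = v ∘ (w ∘ g) := by
    funext x
    exact (hw.inv (g x)).symm
  rw [hgv]
  exact hw.zv.comp h
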